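/- arXiv:2006.04673 — 3 statements merged into one kernel-verified Lean document; each statement's English description precedes it below -/
import Mathlib

section
/- In the representation of the Boolean algebra of conditionals: (i) ⟦(Ω∖B)∪A ∣ B⟧ = ⟦A∣B⟧ for every event A ⊆ Ω and nonempty event B ⊆ Ω; (ii) ⟦A∩B∣Ω⟧ = ⟦A∣B⟧ ∩ ⟦B∣Ω⟧ for every event A ⊆ Ω and nonempty event B ⊆ Ω; (iii) ⟦A∩B∣C⟧ = ⟦A∣B∩C⟧ ∩ ⟦B∣C⟧ for all events A, B ⊆ Ω and nonempty C ⊆ Ω with B∩C nonempty. -/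
open Finset

variable {Ω : Type*}

noncomputable def sigmaFirst [Fintype Ω] [DecidableEq Ω] [Nonempty Ω]
    (σ : Fin (Fintype.card Ω) ≃ Ω) (B : Finset Ω) : Ω :=
  if h : (Finset.univ.filter fun i => σ i ∈ B).Nonempty then
    σ ((Finset.univ.filter fun i => σ i ∈ B).min' h)
  else Classical.arbitrary Ω

def condEvent [Fintype Ω] [DecidableEq Ω] [Nonempty Ω]
    (A B : Finset Ω) : Set (Fin (Fintype.card Ω) ≃ Ω) :=
  {σ | sigmaFirst σ B ∈ A}

theorem sigmaFirst_spec [Fintype Ω] [DecidableEq Ω] [Nonempty Ω]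
    (σ : Fin (Fintype.card Ω) ≃ Ω) {B : Finset Ω} (hB : B.Nonempty) :
    ∃ i, sigmaFirst σ B = σ i ∧ σ i ∈ B ∧ ∀ j, σ j ∈ B → i ≤ j := by
  obtain ⟨b, hb⟩ := hB
  have h : (Finset.univ.filter fun i => σ i ∈ B).Nonempty := ⟨σ.symm b, by simpa using hb⟩
  refine ⟨_, dif_pos h, (Finset.mem_filter.1 (Finset.min'_mem _ h)).2, fun j hj => ?_⟩
  exact Finset.min'_le _ _ (by simpa using hj)

theorem sigmaFirst_mem [Fintype Ω] [DecidableEq Ω] [Nonempty Ω]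
    (σ : Fin (Fintype.card Ω) ≃ Ω) {B : Finset Ω} (hB : B.Nonempty) :
    sigmaFirst σ B ∈ B := by
  obtain ⟨i, hi, hiB, -⟩ := sigmaFirst_spec σ hB
  exact hi ▸ hiB

theorem sigmaFirst_inter_eq_of_mem [Fintype Ω] [DecidableEq Ω] [Nonempty Ω]
    (σ : Fin (Fintype.card Ω) ≃ Ω) {B C : Finset Ω} (hBC : (B ∩ C).Nonempty)
    (h : sigmaFirst σ C ∈ B) : sigmaFirst σ (B ∩ C) = sigmaFirst σ C := by
  obtain ⟨i, hi, hiC, hmin⟩ := sigmaFirst_spec σ (hBC.mono Finset.inter_subset_right)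
  obtain ⟨j, hj, hjBC, hmin'⟩ := sigmaFirst_spec σ hBC
  rw [hi] at h
  rw [hi, hj, le_antisymm (hmin' i (Finset.mem_inter.2 ⟨h, hiC⟩))
    (hmin j (Finset.mem_inter.1 hjBC).2)]

theorem condEvent_inter [Fintype Ω] [DecidableEq Ω] [Nonempty Ω]
    (A : Finset Ω) {B C : Finset Ω} (hBC : (B ∩ C).Nonempty) :
    condEvent (A ∩ B) C = condEvent A (B ∩ C) ∩ condEvent B C := by
  ext σ
  simp only [condEvent, Set.mem_inter_iff, Set.mem_ofPred_eq, Finset.mem_inter]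
  exact and_congr_left fun h => by rw [sigmaFirst_inter_eq_of_mem σ hBC h]

theorem stmt1 [Fintype Ω] [DecidableEq Ω] [Nonempty Ω] :
    (∀ A B : Finset Ω, B.Nonempty →
      condEvent ((Finset.univ \ B) ∪ A) B = condEvent A B) ∧
    (∀ A B : Finset Ω, B.Nonempty →
      condEvent (A ∩ B) (Finset.univ : Finset Ω) =
        condEvent A B ∩ condEvent B Finset.univ) ∧
    (∀ A B C : Finset Ω, C.Nonempty → (B ∩ C).Nonempty →
      condEvent (A ∩ B) C = condEvent A (B ∩ C) ∩ condEvent B C) := by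
  refine ⟨fun A B hB => ?_, fun A B hB => ?_, fun A B C _ hBC => condEvent_inter A hBC⟩
  · ext σ
    simp [condEvent, sigmaFirst_mem σ hB]
  · simpa using condEvent_inter A (B := B) (C := Finset.univ) (by simpa using hB)
end

section
/- (Atomic structure of the algebra of conditionals.) For each tuple ⟨a₁,…,a_{n−1}⟩ of pairwise distinct elements of Ω, the set ω⟨a₁,…,a_{n−1}⟩ := ⋂_{k=1}^{n−1} ⟦{a_k} ∣ Ω∖{a₁,…,a_{k−1}}⟧ is a singleton, consisting exactly of the unique enumeration σ of Ω with σ(k−1) = a_k for all 1 ≤ k ≤ n−1. Consequently the map ⟨a₁,…,a_{n−1}⟩ ↦ ω⟨a₁,…,a_{n−1}⟩ is a bijection between tuples of n−1 pairwise distinct elements of Ω and the atoms (singletons) of the power-set algebra on the set of enumerations, and there are exactly n! of them. -/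
open Finset

variable {Ω : Type*}

def omegaSet [Fintype Ω] [DecidableEq Ω] [Nonempty Ω] {i : ℕ} (a : Fin i → Ω) :
    Set (Fin (Fintype.card Ω) ≃ Ω) :=
  ⋂ k : Fin i,
    condEvent {a k} (Finset.univ \ (Finset.univ.filter fun j : Fin i => j < k).image a)

theorem sigmaFirst_sdiff_image_eq [Fintype Ω] [DecidableEq Ω] [Nonempty Ω] {m : ℕ}
    (hm : m ≤ Fintype.card Ω) (σ : Fin (Fintype.card Ω) ≃ Ω) (a : Fin m → Ω) (k : Fin m)
    (h : ∀ j < k, σ (Fin.castLE hm j) = a j) :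
    sigmaFirst σ (univ \ (univ.filter fun j : Fin m => j < k).image a) =
      σ (Fin.castLE hm k) := by
  have hmem : ∀ i, σ i ∈ univ \ (univ.filter fun j : Fin m => j < k).image a ↔
      Fin.castLE hm k ≤ i := by
    intro i
    simp only [mem_sdiff, mem_univ, true_and, mem_image, mem_filter, not_exists, not_and]
    constructor
    · intro hi
      by_contra hlt
      have hik : (i : ℕ) < k := by simpa [Fin.lt_def] using hlt
      exact hi ⟨i, hik.trans k.isLt⟩ hik (h _ hik).symm
    · intro hi j hj hji
      rw [← h j hj] at hji
      have hij := σ.injective hji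
      subst hij
      exact absurd hj (not_lt.mpr hi)
  have hne : (univ.filter fun i => σ i ∈
      univ \ (univ.filter fun j : Fin m => j < k).image a).Nonempty :=
    ⟨Fin.castLE hm k, by rw [mem_filter, hmem]; exact ⟨mem_univ _, le_rfl⟩⟩
  rw [sigmaFirst, dif_pos hne]
  congr 1
  apply le_antisymm
  · exact min'_le _ _ (by rw [mem_filter, hmem]; exact ⟨mem_univ _, le_rfl⟩)
  · exact le_min' _ _ _ fun i hi => (hmem i).1 (mem_filter.1 hi).2

theorem mem_omegaSet_iff [Fintype Ω] [DecidableEq Ω] [Nonempty Ω] {m : ℕ}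
    (hm : m ≤ Fintype.card Ω) (σ : Fin (Fintype.card Ω) ≃ Ω) (a : Fin m → Ω) :
    σ ∈ omegaSet a ↔ ∀ k, σ (Fin.castLE hm k) = a k := by
  simp only [omegaSet, condEvent, Set.mem_iInter, Set.mem_ofPred_eq, mem_singleton]
  constructor
  · intro h k
    induction k using WellFoundedLT.induction with
    | ind k ih => rw [← sigmaFirst_sdiff_image_eq hm σ a k ih, h k]
  · intro h k
    rw [sigmaFirst_sdiff_image_eq hm σ a k fun j _ => h j, h k]

theorem equiv_eq_of_eq_castLE_pred {n : ℕ} {σ τ : Fin n ≃ Ω}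
    (h : ∀ k : Fin (n - 1), τ (Fin.castLE (Nat.sub_le _ _) k) =
      σ (Fin.castLE (Nat.sub_le _ _) k)) : τ = σ := by
  have h' : ∀ i : Fin n, (i : ℕ) < n - 1 → τ i = σ i := fun i hi => h ⟨i, hi⟩
  ext i
  by_cases hi : (i : ℕ) < n - 1
  · exact h' i hi
  · obtain ⟨j, hj⟩ := τ.surjective (σ i)
    by_cases hjn : (j : ℕ) < n - 1
    · have hji : j = i := σ.injective ((h' j hjn).symm.trans hj)
      exact absurd (hji ▸ hjn) hi
    · have hji : j = i := Fin.ext (by omega)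
      rw [← hj, hji]

theorem exists_equiv_castLE_eq [Fintype Ω] [DecidableEq Ω] [Nonempty Ω] {m : ℕ}
    (hm : m ≤ Fintype.card Ω) (a : Fin m → Ω) (ha : Function.Injective a) :
    ∃ σ : Fin (Fintype.card Ω) ≃ Ω, ∀ k, σ (Fin.castLE hm k) = a k := by
  obtain ⟨g, hg⟩ := Finset.exists_equiv_extend_of_card_eq
    (α := Fin (Fintype.card Ω)) (t := (univ : Finset Ω)) (by simp)
    (s := univ.image (Fin.castLE hm))
    (f := fun i => if h : (i : ℕ) < m then a ⟨i, h⟩ else Classical.arbitrary Ω)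
    (subset_univ _) (by
      intro x hx y hy hxy
      simp only [coe_image, coe_univ, Set.image_univ, Set.mem_range] at hx hy
      obtain ⟨i, rfl⟩ := hx
      obtain ⟨j, rfl⟩ := hy
      have hij : a i = a j := by simpa using hxy
      rw [ha hij])
  refine ⟨g.trans (Equiv.subtypeUnivEquiv mem_univ), fun k => ?_⟩
  simpa using hg (Fin.castLE hm k) (mem_image_of_mem _ (mem_univ k))

theorem stmt6 [Fintype Ω] [DecidableEq Ω] [Nonempty Ω] :
    (∀ a : Fin (Fintype.card Ω - 1) → Ω, Function.Injective a →
      ∃ σ : Fin (Fintype.card Ω) ≃ Ω,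
        omegaSet a = {σ} ∧
        (∀ k : Fin (Fintype.card Ω - 1), σ (Fin.castLE (Nat.sub_le _ _) k) = a k) ∧
        (∀ τ : Fin (Fintype.card Ω) ≃ Ω,
          (∀ k : Fin (Fintype.card Ω - 1), τ (Fin.castLE (Nat.sub_le _ _) k) = a k) →
          τ = σ)) ∧
    (∀ σ : Fin (Fintype.card Ω) ≃ Ω,
      ∃! a : {f : Fin (Fintype.card Ω - 1) → Ω // Function.Injective f},
        omegaSet a.1 = {σ}) ∧
    Nat.card {f : Fin (Fintype.card Ω - 1) → Ω // Function.Injective f} =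
      Nat.factorial (Fintype.card Ω) := by
  have hm : Fintype.card Ω - 1 ≤ Fintype.card Ω := Nat.sub_le _ _
  refine ⟨fun a ha => ?_, fun σ => ?_, ?_⟩
  · obtain ⟨σ, hσ⟩ := exists_equiv_castLE_eq hm a ha
    have huniq : ∀ τ : Fin (Fintype.card Ω) ≃ Ω,
        (∀ k, τ (Fin.castLE hm k) = a k) → τ = σ := fun τ hτ =>
      equiv_eq_of_eq_castLE_pred fun k => (hτ k).trans (hσ k).symm
    refine ⟨σ, ?_, hσ, huniq⟩
    ext τ
    rw [mem_omegaSet_iff hm, Set.mem_singleton_iff]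
    exact ⟨huniq τ, fun h => h ▸ hσ⟩
  · refine ⟨⟨fun k => σ (Fin.castLE hm k),
      σ.injective.comp (Fin.castLE_injective hm)⟩, ?_, ?_⟩
    · ext τ
      rw [mem_omegaSet_iff hm, Set.mem_singleton_iff]
      exact ⟨equiv_eq_of_eq_castLE_pred, fun h k => h ▸ rfl⟩
    · intro b hb
      have hσ : σ ∈ omegaSet b.1 := hb ▸ Set.mem_singleton σ
      exact Subtype.ext (funext fun k => ((mem_omegaSet_iff hm σ b.1).1 hσ k).symm)
  · have hpos : 0 < Fintype.card Ω := Fintype.card_pos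
    rw [Nat.card_congr (Equiv.subtypeInjectiveEquivEmbedding _ _), Nat.card_eq_fintype_card,
      Fintype.card_embedding_eq, Fintype.card_fin, ← Nat.factorial_mul_descFactorial hm,
      Nat.sub_sub_self hpos, Nat.factorial_one, one_mul]
end

section
/- Let A, B, C ⊆ Ω be events such that ∅ ≠ A ⊊ B (proper inclusions) and A ⊊ C. Then ⟦A∣C⟧ ⊆ ⟦A∣B⟧ if and only if B ⊆ C. -/
open Finset

variable {Ω : Type*}

theorem sigmaFirst_eq_of_forall_lt [Fintype Ω] [DecidableEq Ω] [Nonempty Ω]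
    {σ : Fin (Fintype.card Ω) ≃ Ω} {B : Finset Ω} {i : Fin (Fintype.card Ω)}
    (hi : σ i ∈ B) (hlt : ∀ j < i, σ j ∉ B) : sigmaFirst σ B = σ i := by
  have h : (Finset.univ.filter fun i => σ i ∈ B).Nonempty := ⟨i, by simpa using hi⟩
  rw [sigmaFirst, dif_pos h]
  congr 1
  refine le_antisymm (Finset.min'_le _ _ (by simpa using hi)) (Finset.le_min' _ _ _ ?_)
  intro j hj
  by_contra hji
  exact hlt j (not_le.mp hji) (by simpa using hj)

theorem exists_sigmaFirst_eq [Fintype Ω] [DecidableEq Ω] [Nonempty Ω]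
    (σ : Fin (Fintype.card Ω) ≃ Ω) {B : Finset Ω} (hB : B.Nonempty) :
    ∃ i, σ i ∈ B ∧ (∀ j < i, σ j ∉ B) ∧ sigmaFirst σ B = σ i := by
  obtain ⟨b, hb⟩ := hB
  have h : (Finset.univ.filter fun i => σ i ∈ B).Nonempty := ⟨σ.symm b, by simpa using hb⟩
  have hmem : σ ((Finset.univ.filter fun i => σ i ∈ B).min' h) ∈ B := by
    simpa using Finset.min'_mem _ h
  have hlt : ∀ j < (Finset.univ.filter fun i => σ i ∈ B).min' h, σ j ∉ B := fun j hj hjB =>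
    not_le.mpr hj (Finset.min'_le _ _ (by simpa using hjB))
  exact ⟨_, hmem, hlt, sigmaFirst_eq_of_forall_lt hmem hlt⟩

theorem exists_equiv_apply_eq_apply_eq {α β : Type*} [DecidableEq β] (e : α ≃ β)
    {i j : α} (hij : i ≠ j) {a b : β} (hab : a ≠ b) : ∃ σ : α ≃ β, σ i = a ∧ σ j = b := by
  let τ : α ≃ β := e.trans (Equiv.swap (e i) a)
  have hi : τ i = a := by simp [τ]
  have hj : a ≠ τ j := fun h => hij (τ.injective (hi.trans h))
  refine ⟨τ.trans (Equiv.swap (τ j) b), ?_, by simp⟩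
  rw [Equiv.trans_apply, hi, Equiv.swap_apply_of_ne_of_ne hj hab]

theorem stmt8 [Fintype Ω] [DecidableEq Ω] [Nonempty Ω]
    (A B C : Finset Ω) (hA : A.Nonempty) (hAB : A ⊂ B) (hAC : A ⊂ C) :
    condEvent A C ⊆ condEvent A B ↔ B ⊆ C := by
  constructor
  · intro hsub b hbB
    by_contra hbC
    obtain ⟨a, haA⟩ := hA
    have haC : a ∈ C := hAC.subset haA
    have hba : b ≠ a := fun h => hbC (h ▸ haC)
    have hcard : 1 < Fintype.card Ω := Fintype.one_lt_card_iff.mpr ⟨b, a, hba⟩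
    let i : Fin (Fintype.card Ω) := ⟨0, by omega⟩
    let j : Fin (Fintype.card Ω) := ⟨1, hcard⟩
    obtain ⟨σ, hi, hj⟩ := exists_equiv_apply_eq_apply_eq (Fintype.equivFin Ω).symm
      (i := i) (j := j) (by simp [i, j]) hba
    have hC : sigmaFirst σ C = a := by
      rw [← hj]
      refine sigmaFirst_eq_of_forall_lt (hj ▸ haC) fun k hk => ?_
      have hki : k = i := by
        apply Fin.ext
        have : k.val < 1 := hk
        simp only [i]
        omega
      rwa [hki, hi]
    have hB : sigmaFirst σ B = b := by
      rw [← hi]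
      exact sigmaFirst_eq_of_forall_lt (hi ▸ hbB) fun k hk => absurd hk (Nat.not_lt_zero k.val)
    have hmem : sigmaFirst σ B ∈ A := hsub (show sigmaFirst σ C ∈ A from hC ▸ haA)
    exact hbC (hAC.subset (hB ▸ hmem))
  · intro hBC σ hσ
    change sigmaFirst σ C ∈ A at hσ
    change sigmaFirst σ B ∈ A
    obtain ⟨i, -, hlt, hi⟩ := exists_sigmaFirst_eq σ (hA.mono hAC.subset)
    rw [hi] at hσ
    rwa [sigmaFirst_eq_of_forall_lt (hAB.subset hσ) fun j hj hjB => hlt j hj (hBC hjB)]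
end
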